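/- Let k be an even positive integer and let f : ℍ → ℂ be holomorphic. Suppose f|_k T = f, f|_k H₁₁ = ε f for some ε ∈ {1,-1}, f|_k W₁₁ = f, and f|_k T_n = c_n f for n = 2, 3, 4 with some c₂, c₃, c₄ ∈ ℂ. Then the function f − f|_k([[3,-1],[-11,4]]) is constant on ℍ. -/

import Mathlib

open Complex UpperHalfPlane Matrix

/-- Möbius transform of `z ∈ ℍ` under a real 2×2 matrix, as a complex number. -/
noncomputable def moebius (γ : Matrix (Fin 2) (Fin 2) ℝ) (z : ℍ) : ℂ :=
  ((γ 0 0 : ℂ) * (z : ℂ) + (γ 0 1 : ℂ)) / ((γ 1 0 : ℂ) * (z : ℂ) + (γ 1 1 : ℂ))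

/-- Action of a real 2×2 matrix on the upper half-plane.  When the matrix has
positive determinant the Möbius image lies in `ℍ` and the `dite` takes the
first branch, so this agrees with the usual fractional linear action. -/
noncomputable def act (γ : Matrix (Fin 2) (Fin 2) ℝ) (z : ℍ) : ℍ :=
  if h : 0 < (moebius γ z).im then ⟨moebius γ z, h⟩ else z

/-- Weight-`k` slash action `f ∣[k] γ` with the classical normalization
`(det γ)^(k/2) (cz+d)^(-k) f(γz)` (for `k` even, `det γ > 0`). -/
noncomputable def slash (k : ℤ) (γ : Matrix (Fin 2) (Fin 2) ℝ) (f : ℍ → ℂ) : ℍ → ℂ :=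
  fun z => ((γ.det : ℂ) ^ (k / 2)) * (((γ 1 0 : ℂ) * (z : ℂ) + (γ 1 1 : ℂ)) ^ (-k)) * f (act γ z)

/-- The Hecke operator `T_n` (trivial character):
`f ∣[k] T_n = Σ_{ad = n, a,d > 0, 0 ≤ b < d} f ∣[k] [[a,b],[0,d]]`. -/
noncomputable def hecke (k : ℤ) (n : ℕ) (f : ℍ → ℂ) : ℍ → ℂ :=
  fun z => ∑ a ∈ n.divisors, ∑ b ∈ Finset.range (n / a),
    slash k !![(a : ℝ), (b : ℝ); 0, ((n / a : ℕ) : ℝ)] f z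

/-- The matrix `T = [[1,1],[0,1]]`. -/
noncomputable def Tmat : Matrix (Fin 2) (Fin 2) ℝ := !![1, 1; 0, 1]

/-- The Fricke matrix `H_N = [[0,-1],[N,0]]`. -/
noncomputable def Hmat (N : ℕ) : Matrix (Fin 2) (Fin 2) ℝ := !![0, -1; (N : ℝ), 0]

/-- The matrix `W_N = [[1,0],[N,1]]`. -/
noncomputable def Wmat (N : ℕ) : Matrix (Fin 2) (Fin 2) ℝ := !![1, 0; (N : ℝ), 1]

/-- The matrix `β(x) = [[1,x],[0,1]]`. -/
noncomputable def betaMat (x : ℝ) : Matrix (Fin 2) (Fin 2) ℝ := !![1, x; 0, 1]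
lemma im_moebius (γ : Matrix (Fin 2) (Fin 2) ℝ) (z : ℍ) :
    (moebius γ z).im =
      γ.det * z.im / Complex.normSq ((γ 1 0 : ℂ) * (z : ℂ) + (γ 1 1 : ℂ)) := by
  rw [moebius, Complex.div_im, Matrix.det_fin_two]
  simp
  ring

lemma denom_ne_zero_of_det_pos {γ : Matrix (Fin 2) (Fin 2) ℝ} (hγ : 0 < γ.det) (z : ℍ) :
    (γ 1 0 : ℂ) * (z : ℂ) + (γ 1 1 : ℂ) ≠ 0 := by
  intro h
  have him : γ 1 0 * z.im = 0 := by simpa using congrArg Complex.im h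
  have hc : γ 1 0 = 0 := (mul_eq_zero.mp him).resolve_right z.im_pos.ne'
  have hd : γ 1 1 = 0 := by simpa [hc] using congrArg Complex.re h
  simp [Matrix.det_fin_two, hc, hd] at hγ

lemma coe_act {γ : Matrix (Fin 2) (Fin 2) ℝ} (hγ : 0 < γ.det) (z : ℍ) :
    ((act γ z : ℍ) : ℂ) = moebius γ z := by
  have h : 0 < (moebius γ z).im := by
    rw [im_moebius]
    exact div_pos (mul_pos hγ z.im_pos)
      (Complex.normSq_pos.mpr (denom_ne_zero_of_det_pos hγ z))
  simp [act, h]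

lemma denom_mul {γ δ : Matrix (Fin 2) (Fin 2) ℝ} (hδ : 0 < δ.det) (z : ℍ) :
    ((γ * δ) 1 0 : ℂ) * (z : ℂ) + ((γ * δ) 1 1 : ℂ) =
      ((γ 1 0 : ℂ) * (act δ z : ℂ) + (γ 1 1 : ℂ)) *
        ((δ 1 0 : ℂ) * (z : ℂ) + (δ 1 1 : ℂ)) := by
  have h := denom_ne_zero_of_det_pos hδ z
  rw [coe_act hδ, moebius]
  simp only [Matrix.mul_apply, Fin.sum_univ_two]
  push_cast
  field_simp
  ring

lemma act_mul {γ δ : Matrix (Fin 2) (Fin 2) ℝ} (hγ : 0 < γ.det) (hδ : 0 < δ.det) (z : ℍ) :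
    act (γ * δ) z = act γ (act δ z) := by
  have h := denom_ne_zero_of_det_pos hδ z
  have h' := denom_ne_zero_of_det_pos hγ (act δ z)
  have hγδ : 0 < (γ * δ).det := by rw [Matrix.det_mul]; exact mul_pos hγ hδ
  apply UpperHalfPlane.ext
  rw [coe_act hγδ, coe_act hγ, moebius, moebius, denom_mul hδ, div_eq_div_iff (mul_ne_zero h' h) h']
  rw [coe_act hδ, moebius]
  simp only [Matrix.mul_apply, Fin.sum_univ_two]
  push_cast
  field_simp
  ring

lemma slash_mul (k : ℤ) {γ δ : Matrix (Fin 2) (Fin 2) ℝ} (hγ : 0 < γ.det) (hδ : 0 < δ.det)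
    (f : ℍ → ℂ) : slash k (γ * δ) f = slash k δ (slash k γ f) := by
  funext z
  simp only [slash]
  rw [denom_mul hδ, act_mul hγ hδ, Matrix.det_mul, mul_zpow]
  push_cast
  rw [mul_zpow]
  ring

lemma slash_scalar_mul {k : ℤ} (hke : Even k) {r : ℝ} (hr : r ≠ 0)
    (γ : Matrix (Fin 2) (Fin 2) ℝ) (f : ℍ → ℂ) : slash k (r • γ) f = slash k γ f := by
  have hr' : (r : ℂ) ≠ 0 := by exact_mod_cast hr
  obtain ⟨m, rfl⟩ := hke
  funext z
  have hact : act (r • γ) z = act γ z := by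
    have : moebius (r • γ) z = moebius γ z := by
      simp only [moebius, Matrix.smul_apply, smul_eq_mul]
      push_cast
      rw [mul_assoc, mul_assoc, ← mul_add, ← mul_add, mul_div_mul_left _ _ hr']
    simp only [act, this]
  simp only [slash, hact, Matrix.det_smul, Fintype.card_fin, Matrix.smul_apply, smul_eq_mul]
  push_cast
  rw [mul_assoc (r : ℂ), ← mul_add, mul_zpow, mul_zpow, ← zpow_natCast, ← _root_.zpow_mul,
    show (m + m) / 2 = m by lia, show ((2 : ℕ) : ℤ) * m = m + m by push_cast; ring, zpow_neg (r : ℂ)]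
  have : (r : ℂ) ^ (m + m) ≠ 0 := zpow_ne_zero _ hr'
  field_simp

lemma slash_sub (k : ℤ) (γ : Matrix (Fin 2) (Fin 2) ℝ) (f g : ℍ → ℂ) :
    slash k γ (f - g) = slash k γ f - slash k γ g := by
  funext z; simp only [slash, Pi.sub_apply]; ring

lemma slash_add (k : ℤ) (γ : Matrix (Fin 2) (Fin 2) ℝ) (f g : ℍ → ℂ) :
    slash k γ (f + g) = slash k γ f + slash k γ g := by
  funext z; simp only [slash, Pi.add_apply]; ring

lemma slash_smul (k : ℤ) (γ : Matrix (Fin 2) (Fin 2) ℝ) (c : ℂ) (f : ℍ → ℂ) :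
    slash k γ (c • f) = c • slash k γ f := by
  funext z; simp only [slash, Pi.smul_apply, smul_eq_mul]; ring

lemma slash_slash_of_mul_eq {k : ℤ} (hke : Even k) (f : ℍ → ℂ)
    {a b c d a' b' c' d' a'' b'' c'' d'' : ℝ} (r : ℝ)
    (h : 0 < a * d - b * c ∧ 0 < a' * d' - b' * c' ∧ r ≠ 0 ∧
      a * a' + b * c' = r * a'' ∧ a * b' + b * d' = r * b'' ∧
      c * a' + d * c' = r * c'' ∧ c * b' + d * d' = r * d'') :
    slash k !![a', b'; c', d'] (slash k !![a, b; c, d] f) = slash k !![a'', b''; c'', d''] f := by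
  obtain ⟨h₁, h₂, hr, ha, hb, hc, hd⟩ := h
  rw [← slash_mul k (by rwa [Matrix.det_fin_two_of]) (by rwa [Matrix.det_fin_two_of]),
    ← slash_scalar_mul hke hr !![a'', b''; c'', d'']]
  congr 1
  simp [ha, hb, hc, hd]

lemma slash_one (k : ℤ) (f : ℍ → ℂ) : slash k !![1, 0; 0, 1] f = f := by
  funext z
  have h : act !![1, 0; 0, 1] z = z := by
    apply UpperHalfPlane.ext
    rw [coe_act (by simp)]
    simp [moebius]
  simp [slash, h]

lemma slash_fricke_conj {k : ℤ} (hke : Even k) {f : ℍ → ℂ} {ε : ℂ}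
    (hH : slash k (Hmat 11) f = ε • f) {a d : ℝ} (b : ℝ) (had : 0 < a * d) :
    slash k !![d, 0; -11 * b, a] f = ε • slash k (Hmat 11) (slash k !![a, b; 0, d] f) := by
  rw [← slash_smul, ← slash_smul, ← hH, Hmat,
    slash_slash_of_mul_eq hke f (a'' := 0) (b'' := -d) (c'' := 11 * a) (d'' := 11 * b) 1
      (by norm_num; exact had),
    slash_slash_of_mul_eq hke f (a'' := d) (b'' := 0) (c'' := -11 * b) (d'' := a) (-11)
      (by norm_num; constructor <;> [linarith; constructor <;> ring])]

lemma hecke_fricke_conj {k : ℤ} (hke : Even k) {f : ℍ → ℂ} {ε c : ℂ} (hε : ε = 1 ∨ ε = -1)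
    (hH : slash k (Hmat 11) f = ε • f) {n : ℕ} (hn : hecke k n f = c • f) (z : ℍ) :
    ∑ a ∈ n.divisors, ∑ b ∈ Finset.range (n / a),
      slash k !![((n / a : ℕ) : ℝ), 0; -11 * (b : ℝ), (a : ℝ)] f z = c * f z := by
  have hsum : ∀ a ∈ n.divisors, ∀ b ∈ Finset.range (n / a),
      slash k !![((n / a : ℕ) : ℝ), 0; -11 * (b : ℝ), (a : ℝ)] f z =
        ε * slash k (Hmat 11) (slash k !![(a : ℝ), (b : ℝ); 0, ((n / a : ℕ) : ℝ)] f) z := by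
    intro a ha b hb
    have ha' : 0 < a := Nat.pos_of_mem_divisors ha
    have hd' : 0 < n / a := (Nat.zero_le b).trans_lt (Finset.mem_range.mp hb)
    rw [slash_fricke_conj hke hH (b : ℝ) (by positivity)]
    rfl
  rw [Finset.sum_congr rfl fun a ha ↦ Finset.sum_congr rfl (hsum a ha)]
  have h : ε * slash k (Hmat 11) (hecke k n f) z = c * f z := by
    have hε' : ε * ε = 1 := by rcases hε with rfl | rfl <;> norm_num
    rw [hn, slash_smul, hH]
    simp only [Pi.smul_apply, smul_eq_mul]
    linear_combination c * f z * hε'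
  rw [← h]
  simp only [slash, hecke, Finset.mul_sum]

lemma slash_eq_of_hecke_two {k : ℤ} (hke : Even k) {f : ℍ → ℂ} {ε c : ℂ}
    (hε : ε = 1 ∨ ε = -1) (hH : slash k (Hmat 11) f = ε • f) (h2 : hecke k 2 f = c • f) :
    slash k !![2, -1; -11, 6] f = f := by
  have h : slash k !![1, 1; 0, 2] f = slash k !![2, 0; -11, 1] f := by
    funext z
    have hdual := hecke_fricke_conj hke hε hH h2 z
    have h := congrFun h2 z
    simp [hecke, Nat.prime_two.divisors, Finset.sum_range_succ] at h hdual
    linear_combination h - hdual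
  have := congrArg (slash k !![2, -1; 0, 1]) h
  rw [slash_slash_of_mul_eq hke f (a'' := 1) (b'' := 0) (c'' := 0) (d'' := 1) 2 (by norm_num),
    slash_slash_of_mul_eq hke f (a'' := 2) (b'' := -1) (c'' := -11) (d'' := 6) 2 (by norm_num),
    slash_one] at this
  exact this.symm

lemma slash_relation_of_hecke_three {k : ℤ} (hke : Even k) {f : ℍ → ℂ} {ε c : ℂ}
    (hε : ε = 1 ∨ ε = -1) (hT : slash k Tmat f = f) (hH : slash k (Hmat 11) f = ε • f)
    (hW : slash k (Wmat 11) f = f) (h3 : hecke k 3 f = c • f) :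
    slash k !![1, 1; 0, 3] f + slash k !![1, -1; 0, 3] f =
      slash k !![3, 0; -11, 1] f + slash k !![3, 0; 11, 1] f := by
  have hb : slash k !![1, -1; 0, 3] f = slash k !![1, 2; 0, 3] f := by
    nth_rw 1 [← hT]
    exact slash_slash_of_mul_eq hke f 1 (by norm_num)
  have hb' : slash k !![3, 0; -22, 1] f = slash k !![3, 0; 11, 1] f := by
    nth_rw 1 [← hW]
    exact slash_slash_of_mul_eq hke f 1 (by norm_num)
  funext z
  have hdual := hecke_fricke_conj hke hε hH h3 z
  have h := congrFun h3 z
  norm_num [hecke, Nat.prime_three.divisors, Finset.sum_range_succ] at h hdual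
  rw [← hb] at h
  rw [hb'] at hdual
  simp only [Pi.add_apply]
  linear_combination h - hdual

lemma slash_relation_of_hecke_four {k : ℤ} (hke : Even k) {f : ℍ → ℂ} {ε c c' : ℂ}
    (hε : ε = 1 ∨ ε = -1) (hT : slash k Tmat f = f) (hH : slash k (Hmat 11) f = ε • f)
    (hW : slash k (Wmat 11) f = f) (h2 : hecke k 2 f = c • f) (h4 : hecke k 4 f = c' • f) :
    slash k !![1, 1; 0, 4] f + slash k !![1, -1; 0, 4] f =
      slash k !![4, 0; -11, 1] f + slash k !![4, 0; 11, 1] f := by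
  have hG := slash_eq_of_hecke_two hke hε hH h2
  have hb : slash k !![1, -1; 0, 4] f = slash k !![1, 3; 0, 4] f := by
    nth_rw 1 [← hT]
    exact slash_slash_of_mul_eq hke f 1 (by norm_num)
  have hb' : slash k !![4, 0; -33, 1] f = slash k !![4, 0; 11, 1] f := by
    nth_rw 1 [← hW]
    exact slash_slash_of_mul_eq hke f 1 (by norm_num)
  have hm : slash k !![1, 2; 0, 4] f = slash k !![2, 0; -11, 2] f := by
    nth_rw 1 [← hG]
    exact slash_slash_of_mul_eq hke f 1 (by norm_num)
  have hm' : slash k !![2, 1; 0, 2] f = slash k !![4, 0; -22, 1] f := by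
    nth_rw 1 [← hG]
    exact slash_slash_of_mul_eq hke f 1 (by norm_num)
  funext z
  have hdual := hecke_fricke_conj hke hε hH h4 z
  have h := congrFun h4 z
  norm_num [hecke, show (4 : ℕ).divisors = {1, 2, 4} by decide, Finset.sum_range_succ] at h hdual
  rw [← hb, hm, hm'] at h
  rw [hb'] at hdual
  simp only [Pi.add_apply]
  linear_combination h - hdual

/-- The defect of invariance of `f` under `[[3,-1],[-11,4]]` is itself invariant under an
elliptic matrix of infinite order. -/
lemma slash_elliptic_defect {k : ℤ} (hke : Even k) {f : ℍ → ℂ}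
    (h3 : slash k !![1, 1; 0, 3] f + slash k !![1, -1; 0, 3] f =
      slash k !![3, 0; -11, 1] f + slash k !![3, 0; 11, 1] f)
    (h4 : slash k !![1, 1; 0, 4] f + slash k !![1, -1; 0, 4] f =
      slash k !![4, 0; -11, 1] f + slash k !![4, 0; 11, 1] f) :
    slash k !![-16, 4; -33, 6] (f - slash k !![3, -1; -11, 4] f) =
      f - slash k !![3, -1; -11, 4] f := by
  have e3 := congrArg (slash k !![-5, 2; -11, 2]) h3
  have e4 := congrArg (slash k !![1, 0; -11, 4]) h4
  rw [slash_add, slash_add,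
    slash_slash_of_mul_eq hke f (a'' := -16) (b'' := 4) (c'' := -33) (d'' := 6) 1 (by norm_num),
    slash_slash_of_mul_eq hke f (a'' := 2) (b'' := 0) (c'' := -11) (d'' := 2) 3 (by norm_num),
    slash_slash_of_mul_eq hke f (a'' := -15) (b'' := 6) (c'' := 44) (d'' := -20) 1 (by norm_num),
    slash_slash_of_mul_eq hke f (a'' := -5) (b'' := 2) (c'' := -22) (d'' := 8) 3 (by norm_num)]
    at e3
  rw [slash_add, slash_add,
    slash_slash_of_mul_eq hke f (a'' := -5) (b'' := 2) (c'' := -22) (d'' := 8) 2 (by norm_num),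
    slash_slash_of_mul_eq hke f (a'' := 3) (b'' := -1) (c'' := -11) (d'' := 4) 4 (by norm_num),
    slash_slash_of_mul_eq hke f (a'' := 2) (b'' := 0) (c'' := -11) (d'' := 2) 2 (by norm_num),
    slash_slash_of_mul_eq hke f (a'' := 1) (b'' := 0) (c'' := 0) (d'' := 1) 4 (by norm_num),
    slash_one] at e4
  rw [slash_sub,
    slash_slash_of_mul_eq hke f (a'' := -15) (b'' := 6) (c'' := 44) (d'' := -20) 1 (by norm_num)]
  linear_combination e3 + e4

open scoped Manifold Topology

lemma mdifferentiable_slash (k : ℤ) {γ : Matrix (Fin 2) (Fin 2) ℝ} (hγ : 0 < γ.det) {f : ℍ → ℂ}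
    (hf : MDifferentiable 𝓘(ℂ) 𝓘(ℂ) f) : MDifferentiable 𝓘(ℂ) 𝓘(ℂ) (slash k γ f) := by
  rw [UpperHalfPlane.mdifferentiable_iff] at hf ⊢
  have hden : ∀ z : ℂ, 0 < z.im → (γ 1 0 : ℂ) * z + (γ 1 1 : ℂ) ≠ 0 := fun z hz ↦
    denom_ne_zero_of_det_pos hγ ⟨z, hz⟩
  have hmaps : Set.MapsTo (fun z : ℂ ↦
      ((γ 0 0 : ℂ) * z + (γ 0 1 : ℂ)) / ((γ 1 0 : ℂ) * z + (γ 1 1 : ℂ)))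
      {z | 0 < z.im} {z | 0 < z.im} := by
    intro z hz
    have h := (act γ ⟨z, hz⟩).im_pos
    rwa [← UpperHalfPlane.coe_im, coe_act hγ] at h
  have hcomp : DifferentiableOn ℂ (fun z : ℂ ↦ (f ∘ ofComplex)
      (((γ 0 0 : ℂ) * z + (γ 0 1 : ℂ)) / ((γ 1 0 : ℂ) * z + (γ 1 1 : ℂ)))) {z | 0 < z.im} := by
    refine hf.comp (DifferentiableOn.div ?_ ?_ hden) hmaps <;> fun_prop
  have hpow : DifferentiableOn ℂ (fun z : ℂ ↦ ((γ 1 0 : ℂ) * z + (γ 1 1 : ℂ)) ^ (-k))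
      {z | 0 < z.im} := by
    refine DifferentiableOn.zpow ?_ (Or.inl hden)
    fun_prop
  refine ((hpow.const_mul ((γ.det : ℂ) ^ (k / 2))).mul hcomp).congr fun z hz ↦ ?_
  have hact : act γ ⟨z, hz⟩ = ofComplex
      (((γ 0 0 : ℂ) * z + (γ 0 1 : ℂ)) / ((γ 1 0 : ℂ) * z + (γ 1 1 : ℂ))) := by
    rw [ofComplex_apply_of_im_pos (hmaps hz)]
    exact UpperHalfPlane.ext (coe_act hγ _)
  simp [slash, ofComplex_apply_of_im_pos hz, hact]

/-- A root of `3X² + 5X + 3` is not an algebraic integer, hence not a root of unity. -/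
lemma pow_ne_one_of_quadratic {μ : ℂ} (hμ : 3 * μ ^ 2 + 5 * μ + 3 = 0) {n : ℕ} (hn : 0 < n) :
    μ ^ n ≠ 1 := by
  intro h
  have hint : IsIntegral ℤ μ := IsIntegral.of_pow hn (by rw [h]; exact isIntegral_one)
  have hsum : μ + μ ^ (n - 1) = ((-5 / 3 : ℚ) : ℂ) := by
    have hμ0 : μ ≠ 0 := by rintro rfl; norm_num at hμ
    have hinv : μ * μ ^ (n - 1) = 1 := by rw [← pow_succ', Nat.sub_add_cancel hn, h]
    apply mul_left_cancel₀ hμ0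
    push_cast
    linear_combination hinv + hμ / 3
  have hq : IsIntegral ℤ (-5 / 3 : ℚ) := by
    rw [← isIntegral_algebraMap_iff (B := ℂ) (algebraMap ℚ ℂ).injective]
    rw [eq_ratCast, ← hsum]
    exact hint.add (hint.pow (n - 1))
  obtain ⟨m, hm⟩ := IsIntegrallyClosed.isIntegral_iff.mp hq
  have : (3 * m : ℚ) = -5 := by
    simp at hm
    linarith
  have : 3 * m = -5 := by exact_mod_cast this
  lia

lemma eq_zero_of_slash_elliptic {k : ℤ} (hk : 0 < k) (hke : Even k) {g : ℍ → ℂ}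
    (hg : MDifferentiable 𝓘(ℂ) 𝓘(ℂ) g) (h : slash k !![-16, 4; -33, 6] g = g) : g = 0 := by
  have hs : (Real.sqrt 11 : ℂ) ^ 2 = 11 := by
    exact_mod_cast Real.sq_sqrt (show (0 : ℝ) ≤ 11 by norm_num)
  set z₀ : ℂ := 1 / 3 + Real.sqrt 11 / 33 * Complex.I with hz₀
  have hz₀im : 0 < z₀.im := by
    have : z₀.im = Real.sqrt 11 / 33 := by simp [hz₀, div_eq_mul_inv]
    rw [this]; positivity
  have hquad : 33 * z₀ ^ 2 - 22 * z₀ + 4 = 0 := by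
    rw [hz₀]
    linear_combination (-1 / 33 : ℂ) * hs + (Real.sqrt 11 : ℂ) ^ 2 / 33 * I_sq
  set j : ℂ → ℂ := fun z ↦ (-33 * z + 6) / 6 with hj
  set φ : ℂ → ℂ := fun z ↦ (-16 * z + 4) / (-33 * z + 6) with hφ
  have hjne : ∀ z : ℂ, 0 < z.im → -33 * z + 6 ≠ 0 := by
    intro z hz h0
    have := congrArg Complex.im h0
    simp at this
    exact hz.ne' this
  have hμ : 3 * j z₀ ^ 2 + 5 * j z₀ + 3 = 0 := by
    simp only [hj]; linear_combination 11 / 4 * hquad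
  have hφsub : ∀ z : ℂ, 0 < z.im → (φ z - z₀) * (j z * j z₀) = z - z₀ := by
    intro z hz
    have := hjne z hz
    simp only [hφ, hj]
    have hc : (-16 * z + 4) / (-33 * z + 6) * (-33 * z + 6) = -16 * z + 4 := div_mul_cancel₀ _ this
    linear_combination (-33 * z₀ + 6) / 36 * hc - (33 * z - 6) / 36 * hquad
  have hjz₀ : j z₀ ≠ 0 := div_ne_zero (hjne z₀ hz₀im) (by norm_num)
  have hφz₀ : φ z₀ = z₀ := by
    have := hφsub z₀ hz₀im
    rw [sub_self, mul_eq_zero] at this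
    exact sub_eq_zero.mp (this.resolve_right (mul_ne_zero hjz₀ hjz₀))
  have hφc : ContinuousAt φ z₀ := by
    refine ContinuousAt.div ?_ ?_ (hjne z₀ hz₀im) <;> fun_prop
  have hjc : ContinuousAt j z₀ := by fun_prop
  have hupper : ∀ᶠ z in 𝓝 z₀, 0 < z.im := isOpen_upperHalfPlaneSet.mem_nhds hz₀im
  have htransf : ∀ z : ℂ, 0 < z.im → (g ∘ ofComplex) (φ z) = j z ^ k * (g ∘ ofComplex) z := by
    intro z hz
    have hdet : (!![-16, 4; -33, 6] : Matrix (Fin 2) (Fin 2) ℝ).det = 36 := by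
      rw [Matrix.det_fin_two_of]; norm_num
    have hcoe : ((act !![-16, 4; -33, 6] ⟨z, hz⟩ : ℍ) : ℂ) = φ z := by
      rw [coe_act (by rw [hdet]; norm_num)]
      simp [moebius, hφ]
    have hz' := congrFun h ⟨z, hz⟩
    obtain ⟨m, rfl⟩ := hke
    have h36 : ((36 : ℝ) : ℂ) ^ ((m + m) / 2) = 6 ^ (m + m) := by
      rw [show (m + m) / 2 = m by lia, ← two_mul, _root_.zpow_mul]; norm_num
    have hne : (-33 * z + 6) ^ (m + m) ≠ 0 := zpow_ne_zero _ (hjne z hz)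
    have hc : ((!![-16, 4; -33, 6] : Matrix (Fin 2) (Fin 2) ℝ) 1 0 : ℂ) = -33 := by simp
    have hd : ((!![-16, 4; -33, 6] : Matrix (Fin 2) (Fin 2) ℝ) 1 1 : ℂ) = 6 := by simp
    simp only [slash, hdet, hc, hd, h36, _root_.zpow_neg] at hz'
    simp only [Function.comp_apply, ofComplex_apply_of_im_pos hz, ← hcoe, ofComplex_apply]
    rw [← hz']
    simp only [hj, div_zpow]
    have h6 : (6 : ℂ) ^ (m + m) ≠ 0 := zpow_ne_zero _ (by norm_num)
    generalize (-33 * z + 6) ^ (m + m) = a at hne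
    field_simp
  have han : AnalyticOnNhd ℂ (g ∘ ofComplex) {z | 0 < z.im} :=
    (UpperHalfPlane.mdifferentiable_iff.mp hg).analyticOnNhd isOpen_upperHalfPlaneSet
  have hloc : ∀ᶠ z in 𝓝 z₀, (g ∘ ofComplex) z = 0 := by
    by_contra hne
    obtain ⟨n, u, hu, hu0, hfac⟩ := (han z₀ hz₀im).exists_eventuallyEq_pow_smul_nonzero_iff.mpr hne
    have hφt : Filter.Tendsto φ (𝓝 z₀) (𝓝 z₀) := by
      have := hφc.tendsto
      rwa [hφz₀] at this
    have hfacφ : ∀ᶠ z in 𝓝 z₀, (g ∘ ofComplex) (φ z) = (φ z - z₀) ^ n • u (φ z) :=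
      hφt.eventually hfac
    have hEq : ∀ᶠ z in 𝓝[≠] z₀, u (φ z) = j z ^ k * (j z * j z₀) ^ n * u z := by
      filter_upwards [hfac.filter_mono nhdsWithin_le_nhds, hfacφ.filter_mono nhdsWithin_le_nhds,
        hupper.filter_mono nhdsWithin_le_nhds, self_mem_nhdsWithin] with z h1 h2 hz hzne
      have hne' : φ z - z₀ ≠ 0 := by
        intro h0
        have := hφsub z hz
        rw [h0, zero_mul] at this
        exact hzne (sub_eq_zero.mp this.symm)
      apply mul_left_cancel₀ (pow_ne_zero n hne')
      have h3 := htransf z hz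
      rw [h1, h2, ← hφsub z hz, smul_eq_mul, smul_eq_mul, mul_pow] at h3
      rw [h3]; ring
    have hL : ContinuousAt (fun z ↦ u (φ z)) z₀ :=
      ContinuousAt.comp (by rw [hφz₀]; exact hu.continuousAt) hφc
    have hR : ContinuousAt (fun z ↦ j z ^ k * (j z * j z₀) ^ n * u z) z₀ :=
      (((hjc.zpow₀ k (Or.inl hjz₀)).mul ((hjc.mul continuousAt_const).pow n)).mul hu.continuousAt)
    have hval := tendsto_nhds_unique_of_eventuallyEq (hL.tendsto.mono_left nhdsWithin_le_nhds)
      (hR.tendsto.mono_left (nhdsWithin_le_nhds (s := {z₀}ᶜ))) hEq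
    simp only [hφz₀] at hval
    lift k to ℕ using hk.le
    refine pow_ne_one_of_quadratic hμ (n := k + 2 * n) (by lia) ?_
    apply mul_right_cancel₀ hu0
    rw [zpow_natCast] at hval
    rw [pow_add, pow_mul, one_mul, pow_two]
    exact hval.symm
  refine UpperHalfPlane.eq_zero_of_frequently hg (τ := ⟨z₀, hz₀im⟩) (Filter.Eventually.frequently ?_)
  have hτ : ∀ᶠ z : ℍ in 𝓝 ⟨z₀, hz₀im⟩, g z = 0 := by
    filter_upwards [UpperHalfPlane.continuous_coe.continuousAt.eventually hloc] with z hz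
    simpa using hz
  exact hτ.filter_mono nhdsWithin_le_nhds

open scoped Manifold in
theorem level_11_missing_generator (k : ℤ) (hk : 0 < k) (hke : Even k) (f : ℍ → ℂ)
    (hf : MDifferentiable 𝓘(ℂ) 𝓘(ℂ) f)
    (ε : ℂ) (hε : ε = 1 ∨ ε = -1) (c₂ c₃ c₄ : ℂ)
    (hT : slash k Tmat f = f) (hH : slash k (Hmat 11) f = ε • f)
    (hW : slash k (Wmat 11) f = f)
    (h2 : hecke k 2 f = c₂ • f) (h3 : hecke k 3 f = c₃ • f) (h4 : hecke k 4 f = c₄ • f) :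
    ∃ c : ℂ, ∀ z : ℍ, (f - slash k !![(3 : ℝ), -1; -11, 4] f) z = c := by
  have hinv := slash_elliptic_defect hke (slash_relation_of_hecke_three hke hε hT hH hW h3)
    (slash_relation_of_hecke_four hke hε hT hH hW h2 h4)
  have hdiff : MDifferentiable 𝓘(ℂ) 𝓘(ℂ) (f - slash k !![(3 : ℝ), -1; -11, 4] f) :=
    hf.sub (mdifferentiable_slash k (by rw [Matrix.det_fin_two_of]; norm_num) hf)
  exact ⟨0, fun z ↦ congrFun (eq_zero_of_slash_elliptic hk hke hdiff hinv) z⟩
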